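/- Fix a dyadic cube Q₀∈D(ℝ^n), θ₁,θ₂>1, and nonnegative measurable f,g with |f|^{θ₁} and |g|^{θ₂} locally integrable. Let A=(4·18^n)^{1/θ₁+1/θ₂} and γ=(⨍_{3Q₀}|f|^{θ₁})^{1/θ₁}(⨍_{3Q₀}|g|^{θ₂})^{1/θ₂}, and assume γ>0. For k=1,2,…, let D_k be the union of all Q∈D(Q₀) with (⨍_{3Q}|f|^{θ₁})^{1/θ₁}(⨍_{3Q}|g|^{θ₂})^{1/θ₂} > γA^k, and write D_k = ∪_j Q_j^k where the Q_j^k are the maximal such dyadic cubes. Then: (1) γA^k < (⨍_{3Q_j^k}|f|^{θ₁})^{1/θ₁}(⨍_{3Q_j^k}|g|^{θ₂})^{1/θ₂} ≤ 2^{n(1/θ₁+1/θ₂)}γA^k for every k,j; and (2) with E₀ := Q₀∖D₁ and E_j^k := Q_j^k∖D_{k+1}, one has |Q₀| ≤ 2|E₀| and |Q_j^k| ≤ 2|E_j^k| for all k,j (in particular the sets E₀ and E_j^k are pairwise disjoint and their union is Q₀). -/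

import Mathlib

open MeasureTheory ENNReal

noncomputable section

/-- The dyadic cube `2^{-k}([0,1)^n + m)` in `ℝ^n`. -/
def dyadicCube (n : ℕ) (k : ℤ) (m : Fin n → ℤ) : Set (EuclideanSpace ℝ (Fin n)) :=
  {x | ∀ i, (m i : ℝ) ≤ (2 : ℝ) ^ k * x i ∧ (2 : ℝ) ^ k * x i < (m i : ℝ) + 1}

/-- The concentric triple `3Q` of the dyadic cube with parameters `k, m`. -/
def tripleCube (n : ℕ) (k : ℤ) (m : Fin n → ℤ) : Set (EuclideanSpace ℝ (Fin n)) :=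
  {x | ∀ i, (m i : ℝ) - 1 ≤ (2 : ℝ) ^ k * x i ∧ (2 : ℝ) ^ k * x i < (m i : ℝ) + 2}

/-- `Q` is a dyadic cube. -/
def IsDyadicCube {n : ℕ} (Q : Set (EuclideanSpace ℝ (Fin n))) : Prop :=
  ∃ (k : ℤ) (m : Fin n → ℤ), Q = dyadicCube n k m

/-- A (closed) cube with sides parallel to the axes. -/
def IsCube {n : ℕ} (Q : Set (EuclideanSpace ℝ (Fin n))) : Prop :=
  ∃ (a : EuclideanSpace ℝ (Fin n)) (d : ℝ), 0 < d ∧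
    Q = {x | ∀ i, a i ≤ x i ∧ x i ≤ a i + d}

/-- The average `⨍_Q f` of an `ℝ≥0∞`-valued function. -/
def setAvg {n : ℕ} (Q : Set (EuclideanSpace ℝ (Fin n)))
    (f : EuclideanSpace ℝ (Fin n) → ℝ≥0∞) : ℝ≥0∞ :=
  (volume Q)⁻¹ * ∫⁻ x in Q, f x

/-- The mean `m_Q(b)` of a real-valued function. -/
def setMean {n : ℕ} (Q : Set (EuclideanSpace ℝ (Fin n)))
    (b : EuclideanSpace ℝ (Fin n) → ℝ) : ℝ :=
  (∫ x in Q, b x) / (volume Q).toReal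

/-- The (dyadic) Morrey norm `‖f‖_{M_q^p}` (first exponent `p`, second `q`). -/
def morreyNorm {n : ℕ} (p q : ℝ) (f : EuclideanSpace ℝ (Fin n) → ℝ≥0∞) : ℝ≥0∞ :=
  ⨆ (Q : Set (EuclideanSpace ℝ (Fin n))) (_ : IsDyadicCube Q),
    volume Q ^ (1 / p) * (setAvg Q fun x => f x ^ q) ^ (1 / q)

/-- The weighted Morrey norm `‖f‖_{M_q^p(w)}` (supremum over all cubes). -/
def wMorreyNorm {n : ℕ} (p q : ℝ) (w f : EuclideanSpace ℝ (Fin n) → ℝ≥0∞) : ℝ≥0∞ :=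
  ⨆ (Q : Set (EuclideanSpace ℝ (Fin n))) (_ : IsCube Q),
    (∫⁻ x in Q, w x) ^ (1 / p - 1 / q) * (∫⁻ x in Q, f x ^ q * w x) ^ (1 / q)

/-- The bilinear fractional integral operator `B_α`. -/
def Bop {n : ℕ} (α : ℝ) (f g : EuclideanSpace ℝ (Fin n) → ℝ)
    (x : EuclideanSpace ℝ (Fin n)) : ℝ :=
  ∫ y, f (x - y) * g (x + y) * ‖y‖ ^ (α - (n : ℝ))

/-- The bilinear fractional maximal operator `M_{α,R⃗}`, `R⃗ = (r₁, r₂)`. -/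
def Mop {n : ℕ} (α r₁ r₂ : ℝ) (f g : EuclideanSpace ℝ (Fin n) → ℝ≥0∞)
    (x : EuclideanSpace ℝ (Fin n)) : ℝ≥0∞ :=
  ⨆ (Q : Set (EuclideanSpace ℝ (Fin n))) (_ : IsDyadicCube Q) (_ : x ∈ Q),
    volume Q ^ (α / (n : ℝ)) * (setAvg Q fun y => f y ^ r₁) ^ (1 / r₁) *
      (setAvg Q fun z => g z ^ r₂) ^ (1 / r₂)

/-- The BMO norm `‖b‖_{BMO}` (supremum over all axes-parallel cubes). -/
def bmoNorm {n : ℕ} (b : EuclideanSpace ℝ (Fin n) → ℝ) : ℝ≥0∞ :=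
  ⨆ (Q : Set (EuclideanSpace ℝ (Fin n))) (_ : IsCube Q),
    setAvg Q fun x => ENNReal.ofReal |b x - setMean Q b|

/-- The conjugate exponent `e' = e / (e - 1)`. -/
def conjExp (e : ℝ) : ℝ := e / (e - 1)

abbrev BilinOp (n : ℕ) :=
  (EuclideanSpace ℝ (Fin n) → ℝ) → (EuclideanSpace ℝ (Fin n) → ℝ) →
    EuclideanSpace ℝ (Fin n) → ℝ

/-- The commutator `[b,T]_β` of a bilinear operator; `β = 0` acts on the first slot,
`β = 1` on the second. -/
def commut {n : ℕ} (β : Fin 2) (b : EuclideanSpace ℝ (Fin n) → ℝ) (T : BilinOp n) :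
    BilinOp n := fun f g x =>
  if β = 0 then b x * T f g x - T (fun y => b y * f y) g x
  else b x * T f g x - T f (fun y => b y * g y) x

/-- The iterated commutator `[b⃗,T]_{β⃗} = [b_N,[…,[b₁,T]_{β₁}…]_{β_N}]`. -/
def iterComm {n : ℕ} : (N : ℕ) → (Fin N → EuclideanSpace ℝ (Fin n) → ℝ) →
    (Fin N → Fin 2) → BilinOp n → BilinOp n
  | 0, _, _, T => T
  | (N + 1), b, β, T =>
      commut (β (Fin.last N)) (b (Fin.last N))
        (iterComm N (fun i => b i.castSucc) (fun i => β i.castSucc) T)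

/-- The Muckenhoupt class `A_p`. -/
def IsAp {n : ℕ} (p : ℝ) (w : EuclideanSpace ℝ (Fin n) → ℝ≥0∞) : Prop :=
  ∃ C : ℝ≥0∞, C ≠ ∞ ∧ ∀ Q, IsCube Q →
    setAvg Q w * (setAvg Q fun x => w x ^ (1 - conjExp p)) ^ (p - 1) ≤ C

/-- The class `A_∞ = ⋃_{p>1} A_p`. -/
def IsAinfty {n : ℕ} (w : EuclideanSpace ℝ (Fin n) → ℝ≥0∞) : Prop :=
  ∃ p : ℝ, 1 < p ∧ IsAp p w

/-- The reverse Hölder class `RH_ν`. -/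
def IsRH {n : ℕ} (ν : ℝ) (w : EuclideanSpace ℝ (Fin n) → ℝ≥0∞) : Prop :=
  ∃ C : ℝ≥0∞, C ≠ ∞ ∧ ∀ Q, IsCube Q →
    (setAvg Q fun x => w x ^ ν) ^ (1 / ν) ≤ C * setAvg Q w

/-- The bilinear maximal function associated to the bilinear Hilbert transform. -/
def BHop {n : ℕ} (f g : EuclideanSpace ℝ (Fin n) → ℝ)
    (x : EuclideanSpace ℝ (Fin n)) : ℝ≥0∞ :=
  ⨆ (ρ : ℝ) (_ : 0 < ρ),
    (ENNReal.ofReal ((2 * ρ) ^ n))⁻¹ *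
      ∫⁻ y in {y : EuclideanSpace ℝ (Fin n) | ∀ i, |y i| ≤ ρ},
        ENNReal.ofReal |f (x - y) * g (x + y)|

/-- The factor `(⨍_Q v^{at/(1-t)})^{(1-t)/(at)}`, interpreted as `‖v‖_{L^∞(Q)}` when `t = 1`. -/
def vFactor {n : ℕ} (a t : ℝ) (v : EuclideanSpace ℝ (Fin n) → ℝ≥0∞)
    (Q : Set (EuclideanSpace ℝ (Fin n))) : ℝ≥0∞ :=
  if t = 1 then essSup v (volume.restrict Q)
  else (setAvg Q fun x => v x ^ (a * t / (1 - t))) ^ ((1 - t) / (a * t))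

/-- `sup_Q |Q|^{1/p} (⨍_Q (|f|w₁)^{q₁})^{1/q₁} (⨍_Q (|g|w₂)^{q₂})^{1/q₂}`. -/
def inputNorm {n : ℕ} (p q₁ q₂ : ℝ) (w₁ w₂ : EuclideanSpace ℝ (Fin n) → ℝ≥0∞)
    (f g : EuclideanSpace ℝ (Fin n) → ℝ) : ℝ≥0∞ :=
  ⨆ (Q : Set (EuclideanSpace ℝ (Fin n))) (_ : IsDyadicCube Q),
    volume Q ^ (1 / p) *
      (setAvg Q fun x => (ENNReal.ofReal |f x| * w₁ x) ^ q₁) ^ (1 / q₁) *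
      (setAvg Q fun x => (ENNReal.ofReal |g x| * w₂ x) ^ q₂) ^ (1 / q₂)

/-- `sup_Q |Q|^{1/p} (⨍_Q |f|^{q₁} u₁)^{1/q₁} (⨍_Q |g|^{q₂} u₂)^{1/q₂}`. -/
def inputNormW {n : ℕ} (p q₁ q₂ : ℝ) (u₁ u₂ : EuclideanSpace ℝ (Fin n) → ℝ≥0∞)
    (f g : EuclideanSpace ℝ (Fin n) → ℝ) : ℝ≥0∞ :=
  ⨆ (Q : Set (EuclideanSpace ℝ (Fin n))) (_ : IsDyadicCube Q),
    volume Q ^ (1 / p) *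
      (setAvg Q fun x => ENNReal.ofReal |f x| ^ q₁ * u₁ x) ^ (1 / q₁) *
      (setAvg Q fun x => ENNReal.ofReal |g x| ^ q₂ * u₂ x) ^ (1 / q₂)


/-- The quantity `(⨍_{3Q}|f|^{θ₁})^{1/θ₁}(⨍_{3Q}|g|^{θ₂})^{1/θ₂}` attached to the dyadic
cube with parameters `l, m`. -/
def czAvg {n : ℕ} (θ₁ θ₂ : ℝ) (f g : EuclideanSpace ℝ (Fin n) → ℝ≥0∞)
    (l : ℤ) (m : Fin n → ℤ) : ℝ≥0∞ :=
  (setAvg (tripleCube n l m) fun x => f x ^ θ₁) ^ (1 / θ₁) *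
    (setAvg (tripleCube n l m) fun x => g x ^ θ₂) ^ (1 / θ₂)

/-- The family of dyadic subcubes of `Q₀` on which the averaged product exceeds `c`. -/
def czFamily {n : ℕ} (θ₁ θ₂ : ℝ) (f g : EuclideanSpace ℝ (Fin n) → ℝ≥0∞)
    (Q₀ : Set (EuclideanSpace ℝ (Fin n))) (c : ℝ≥0∞) :
    Set (Set (EuclideanSpace ℝ (Fin n))) :=
  {Q | ∃ (l : ℤ) (m : Fin n → ℤ),
    Q = dyadicCube n l m ∧ Q ⊆ Q₀ ∧ c < czAvg θ₁ θ₂ f g l m}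

/-- The half-open axes-parallel box with lower corner `2^{-l} p` and side length `2^{-l} s`. -/
def scaledBox (n : ℕ) (l : ℤ) (p : Fin n → ℝ) (s : ℝ) : Set (EuclideanSpace ℝ (Fin n)) :=
  {x | ∀ i, p i ≤ (2 : ℝ) ^ l * x i ∧ (2 : ℝ) ^ l * x i < p i + s}

lemma scaledBox_eq_preimage (n : ℕ) (l : ℤ) (p : Fin n → ℝ) (s : ℝ) :
    scaledBox n l p s = (WithLp.ofLp : EuclideanSpace ℝ (Fin n) → Fin n → ℝ) ⁻¹'
      Set.univ.pi fun i => Set.Ico (p i / 2 ^ l) ((p i + s) / 2 ^ l) := by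
  have h2 : (0 : ℝ) < 2 ^ l := by positivity
  ext x
  simp only [scaledBox, Set.mem_ofPred_eq, Set.mem_preimage, Set.mem_pi, Set.mem_univ,
    forall_const, Set.mem_Ico, div_le_iff₀ h2, lt_div_iff₀ h2, mul_comm]

lemma measurableSet_scaledBox (n : ℕ) (l : ℤ) (p : Fin n → ℝ) (s : ℝ) :
    MeasurableSet (scaledBox n l p s) := by
  rw [scaledBox_eq_preimage]
  exact (PiLp.volume_preserving_ofLp (Fin n)).measurable
    (MeasurableSet.univ_pi fun _ => measurableSet_Ico)

lemma volume_scaledBox (n : ℕ) (l : ℤ) (p : Fin n → ℝ) (s : ℝ) :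
    volume (scaledBox n l p s) = ENNReal.ofReal (s / 2 ^ l) ^ n := by
  rw [scaledBox_eq_preimage, (PiLp.volume_preserving_ofLp (Fin n)).measure_preimage
    (MeasurableSet.univ_pi fun _ => measurableSet_Ico).nullMeasurableSet, Real.volume_pi_Ico]
  simp [← sub_div]

lemma dyadicCube_eq_scaledBox (n : ℕ) (l : ℤ) (m : Fin n → ℤ) :
    dyadicCube n l m = scaledBox n l (fun i => m i) 1 := rfl

lemma tripleCube_eq_scaledBox (n : ℕ) (l : ℤ) (m : Fin n → ℤ) :
    tripleCube n l m = scaledBox n l (fun i => m i - 1) 3 := by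
  ext x
  simp only [tripleCube, scaledBox, Set.mem_ofPred_eq]
  refine forall_congr' fun i => ?_
  rw [show (m i : ℝ) - 1 + 3 = m i + 2 by ring]

lemma measurableSet_tripleCube (n : ℕ) (l : ℤ) (m : Fin n → ℤ) :
    MeasurableSet (tripleCube n l m) := by
  rw [tripleCube_eq_scaledBox]
  exact measurableSet_scaledBox ..

lemma volume_dyadicCube (n : ℕ) (l : ℤ) (m : Fin n → ℤ) :
    volume (dyadicCube n l m) = ENNReal.ofReal (1 / 2 ^ l) ^ n := by
  rw [dyadicCube_eq_scaledBox, volume_scaledBox]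

lemma volume_scaledBox_eq_mul_dyadicCube {n : ℕ} (l : ℤ) (p : Fin n → ℝ) {s : ℝ} (hs : 0 ≤ s)
    (m : Fin n → ℤ) :
    volume (scaledBox n l p s) = ENNReal.ofReal s ^ n * volume (dyadicCube n l m) := by
  rw [volume_scaledBox, volume_dyadicCube, ← mul_pow, ← ENNReal.ofReal_mul hs, mul_one_div]

lemma volume_tripleCube (n : ℕ) (l : ℤ) (m : Fin n → ℤ) :
    volume (tripleCube n l m) = 3 ^ n * volume (dyadicCube n l m) := by
  rw [tripleCube_eq_scaledBox, volume_scaledBox_eq_mul_dyadicCube l _ (by norm_num) m]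
  norm_num

lemma volume_dyadicCube_ne_zero (n : ℕ) (l : ℤ) (m : Fin n → ℤ) :
    volume (dyadicCube n l m) ≠ 0 := by
  rw [volume_dyadicCube]
  exact pow_ne_zero _ (ENNReal.ofReal_pos.2 (by positivity)).ne'

lemma volume_dyadicCube_ne_top (n : ℕ) (l : ℤ) (m : Fin n → ℤ) :
    volume (dyadicCube n l m) ≠ ∞ := by
  rw [volume_dyadicCube]
  exact ENNReal.pow_ne_top ENNReal.ofReal_ne_top

lemma volume_tripleCube_ne_zero (n : ℕ) (l : ℤ) (m : Fin n → ℤ) :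
    volume (tripleCube n l m) ≠ 0 := by
  rw [volume_tripleCube]
  exact mul_ne_zero (by positivity) (volume_dyadicCube_ne_zero n l m)

lemma volume_tripleCube_ne_top (n : ℕ) (l : ℤ) (m : Fin n → ℤ) :
    volume (tripleCube n l m) ≠ ∞ := by
  rw [volume_tripleCube]
  exact ENNReal.mul_ne_top (by finiteness) (volume_dyadicCube_ne_top n l m)

lemma dyadicCube_nonempty (n : ℕ) (l : ℤ) (m : Fin n → ℤ) : (dyadicCube n l m).Nonempty :=
  nonempty_of_measure_ne_zero (volume_dyadicCube_ne_zero n l m)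

lemma tripleCube_nonempty (n : ℕ) (l : ℤ) (m : Fin n → ℤ) : (tripleCube n l m).Nonempty :=
  nonempty_of_measure_ne_zero (volume_tripleCube_ne_zero n l m)

lemma two_zpow_eq_pow_mul {l l' : ℤ} (h : l ≤ l') :
    (2 : ℝ) ^ l' = 2 ^ (l' - l).toNat * 2 ^ l := by
  rw [← zpow_natCast, Int.toNat_of_nonneg (by lia), ← zpow_add₀ two_ne_zero]
  congr 1
  ring

lemma dyadicCube_index_bounds {n : ℕ} {l l' : ℤ} {m m' : Fin n → ℤ} (h : l ≤ l')
    (hne : (dyadicCube n l' m' ∩ dyadicCube n l m).Nonempty) (i : Fin n) :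
    2 ^ (l' - l).toNat * m i ≤ m' i ∧ m' i + 1 ≤ 2 ^ (l' - l).toNat * (m i + 1) := by
  obtain ⟨x, hx', hx⟩ := hne
  have h1 := hx' i
  have h2 := hx i
  rw [two_zpow_eq_pow_mul h, mul_assoc] at h1
  generalize (l' - l).toNat = j at *
  have hj : (0 : ℝ) < 2 ^ j := by positivity
  have h3 := mul_le_mul_of_nonneg_left h2.1 hj.le
  have h4 := mul_lt_mul_of_pos_left h2.2 hj
  constructor
  · have : ((2 ^ j * m i : ℤ) : ℝ) < ((m' i + 1 : ℤ) : ℝ) := by push_cast; linarith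
    have := Int.cast_lt.1 this
    lia
  · have : ((m' i : ℤ) : ℝ) < ((2 ^ j * (m i + 1) : ℤ) : ℝ) := by push_cast; linarith
    have := Int.cast_lt.1 this
    lia

lemma dyadicCube_index_eq {n : ℕ} {l : ℤ} {m m' : Fin n → ℤ}
    (hne : (dyadicCube n l m' ∩ dyadicCube n l m).Nonempty) : m' = m := by
  ext i
  have h := dyadicCube_index_bounds le_rfl hne i
  simp only [sub_self, Int.toNat_zero, pow_zero, one_mul] at h
  lia

lemma dyadicCube_subset_of_inter_nonempty {n : ℕ} {l l' : ℤ} {m m' : Fin n → ℤ} (h : l ≤ l')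
    (hne : (dyadicCube n l' m' ∩ dyadicCube n l m).Nonempty) :
    dyadicCube n l' m' ⊆ dyadicCube n l m := by
  intro x hx i
  have hb := dyadicCube_index_bounds h hne i
  have h1 := hx i
  rw [two_zpow_eq_pow_mul h, mul_assoc] at h1
  generalize (l' - l).toNat = j at *
  have hj : (0 : ℝ) < 2 ^ j := by positivity
  have b1 : ((2 ^ j * m i : ℤ) : ℝ) ≤ (m' i : ℤ) := Int.cast_le.2 hb.1
  have b2 : ((m' i + 1 : ℤ) : ℝ) ≤ ((2 ^ j * (m i + 1) : ℤ) : ℝ) := Int.cast_le.2 hb.2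
  push_cast at b1 b2
  constructor
  · exact le_of_mul_le_mul_left (by linarith) hj
  · exact lt_of_mul_lt_mul_left (by linarith) hj.le

lemma tripleCube_subset_of_inter_nonempty {n : ℕ} {l l' : ℤ} {m m' : Fin n → ℤ} (h : l ≤ l')
    (hne : (dyadicCube n l' m' ∩ dyadicCube n l m).Nonempty) :
    tripleCube n l' m' ⊆ tripleCube n l m := by
  intro x hx i
  have hb := dyadicCube_index_bounds h hne i
  have h1 := hx i
  rw [two_zpow_eq_pow_mul h, mul_assoc] at h1
  generalize (l' - l).toNat = j at *
  have hj : (1 : ℝ) ≤ 2 ^ j := one_le_pow₀ (by norm_num)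
  have b1 : ((2 ^ j * m i : ℤ) : ℝ) ≤ (m' i : ℤ) := Int.cast_le.2 hb.1
  have b2 : ((m' i + 1 : ℤ) : ℝ) ≤ ((2 ^ j * (m i + 1) : ℤ) : ℝ) := Int.cast_le.2 hb.2
  push_cast at b1 b2
  constructor
  · exact le_of_mul_le_mul_left (a := (2 : ℝ) ^ j) (by linarith) (by linarith)
  · exact lt_of_mul_lt_mul_left (a := (2 : ℝ) ^ j) (by linarith) (by linarith)

lemma le_of_dyadicCube_subset {n : ℕ} (hn : 0 < n) {l l' : ℤ} {m m' : Fin n → ℤ}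
    (h : dyadicCube n l' m' ⊆ dyadicCube n l m) : l ≤ l' := by
  have hv := measure_mono (μ := volume) h
  rw [volume_dyadicCube, volume_dyadicCube, ENNReal.pow_le_pow_left_iff hn.ne',
    ENNReal.ofReal_le_ofReal_iff (by positivity),
    one_div_le_one_div (by positivity) (by positivity)] at hv
  exact (zpow_le_zpow_iff_right₀ _root_.one_lt_two).1 hv

lemma dyadicCube_injective {n : ℕ} (hn : 0 < n) {l l' : ℤ} {m m' : Fin n → ℤ}
    (h : dyadicCube n l' m' = dyadicCube n l m) : l' = l ∧ m' = m := by
  obtain rfl := le_antisymm (le_of_dyadicCube_subset hn h.ge) (le_of_dyadicCube_subset hn h.le)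
  exact ⟨rfl, dyadicCube_index_eq (by rw [h, Set.inter_self]; exact dyadicCube_nonempty ..)⟩

lemma tripleCube_subset_of_dyadicCube_subset {n : ℕ} (hn : 0 < n) {l l' : ℤ}
    {m m' : Fin n → ℤ} (h : dyadicCube n l' m' ⊆ dyadicCube n l m) :
    tripleCube n l' m' ⊆ tripleCube n l m :=
  tripleCube_subset_of_inter_nonempty (le_of_dyadicCube_subset hn h)
    (by rw [Set.inter_eq_left.2 h]; exact dyadicCube_nonempty ..)

lemma dyadicCube_subset_enlargement {n : ℕ} {l l' : ℤ} {m m' : Fin n → ℤ} (h : l ≤ l')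
    (hne : (tripleCube n l' m' ∩ tripleCube n l m).Nonempty) :
    dyadicCube n l' m' ⊆ scaledBox n l (fun i => m i - 4) 9 := by
  obtain ⟨y, hy', hy⟩ := hne
  intro x hx i
  have h1 := hx i
  have h2 := hy' i
  have h3 := hy i
  rw [two_zpow_eq_pow_mul h, mul_assoc] at h1 h2
  generalize (l' - l).toNat = j at *
  have hj : (1 : ℝ) ≤ 2 ^ j := one_le_pow₀ (by norm_num)
  generalize (2 : ℝ) ^ l * x i = X at *
  generalize (2 : ℝ) ^ l * y i = Y at *
  have h4 : X ≤ Y + 2 := le_of_mul_le_mul_left (a := (2 : ℝ) ^ j) (by linarith) (by linarith)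
  have h5 : Y - 2 ≤ X := le_of_mul_le_mul_left (a := (2 : ℝ) ^ j) (by linarith) (by linarith)
  constructor <;> linarith

lemma mul_volume_iUnion_dyadicCube_le {n : ℕ} (hn : 0 < n)
    (h : EuclideanSpace ℝ (Fin n) → ℝ≥0∞) (l : ℤ) (m : Fin n → ℤ) (t : ℝ≥0∞)
    (T : Set (ℤ × (Fin n → ℤ)))
    (hsub : ∀ r ∈ T, dyadicCube n r.1 r.2 ⊆ dyadicCube n l m)
    (hT : ∀ r ∈ T, t ≤ setAvg (tripleCube n r.1 r.2) h) :
    t * volume (⋃ r ∈ T, dyadicCube n r.1 r.2) ≤ 3 ^ n * ∫⁻ x in tripleCube n l m, h x := by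
  obtain ⟨u, hu, hdisj, hcov⟩ := Vitali.exists_disjoint_subfamily_covering_enlargement
    (fun r : ℤ × (Fin n → ℤ) => tripleCube n r.1 r.2) T (fun r => (2 : ℝ) ^ (-r.1)) (3 / 2)
    (by norm_num) (fun _ _ => by positivity) (2 ^ (-l))
    (fun r hr => zpow_le_zpow_right₀ one_le_two
      (neg_le_neg (le_of_dyadicCube_subset hn (hsub r hr))))
    (fun r _ => tripleCube_nonempty ..)
  have hcover : (⋃ r ∈ T, dyadicCube n r.1 r.2) ⊆
      ⋃ b ∈ u, scaledBox n b.1 (fun i => b.2 i - 4) 9 := by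
    refine Set.iUnion₂_subset fun a ha => ?_
    obtain ⟨b, hb, hab, hδ⟩ := hcov a ha
    refine (dyadicCube_subset_enlargement ?_ hab).trans
      (Set.subset_biUnion_of_mem (u := fun b : ℤ × (Fin n → ℤ) =>
        scaledBox n b.1 (fun i => (b.2 i : ℝ) - 4) 9) hb)
    have h2 : (2 : ℝ) ^ (-a.1) < 2 ^ (-b.1 + 1) := by
      rw [zpow_add_one₀ two_ne_zero]
      have : (0 : ℝ) < 2 ^ (-b.1) := by positivity
      linarith
    have := (zpow_lt_zpow_iff_right₀ (_root_.one_lt_two (α := ℝ))).1 h2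
    lia
  have hterm (b : u) : t * volume (scaledBox n b.1.1 (fun i => b.1.2 i - 4) 9) ≤
      3 ^ n * ∫⁻ x in tripleCube n b.1.1 b.1.2, h x := by
    have h9 : volume (scaledBox n b.1.1 (fun i => b.1.2 i - 4) 9) =
        3 ^ n * volume (tripleCube n b.1.1 b.1.2) := by
      rw [volume_tripleCube, volume_scaledBox_eq_mul_dyadicCube _ _ (by norm_num) b.1.2,
        ← mul_assoc, ← mul_pow]
      norm_num
    rw [h9, mul_left_comm]
    gcongr
    have := hT b.1 (hu b.2)
    rwa [setAvg, mul_comm, ← div_eq_mul_inv, ENNReal.le_div_iff_mul_le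
      (.inl (volume_tripleCube_ne_zero n _ _)) (.inl (volume_tripleCube_ne_top n _ _))] at this
  calc t * volume (⋃ r ∈ T, dyadicCube n r.1 r.2)
      ≤ t * ∑' b : u, volume (scaledBox n b.1.1 (fun i => b.1.2 i - 4) 9) := by
        gcongr
        exact (measure_mono hcover).trans (measure_biUnion_le volume u.to_countable _)
    _ ≤ ∑' b : u, 3 ^ n * ∫⁻ x in tripleCube n b.1.1 b.1.2, h x := by
        rw [← ENNReal.tsum_mul_left]
        exact ENNReal.tsum_le_tsum hterm
    _ = 3 ^ n * ∫⁻ x in ⋃ b ∈ u, tripleCube n b.1 b.2, h x := by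
        rw [ENNReal.tsum_mul_left, lintegral_biUnion u.to_countable
          (fun b _ => measurableSet_tripleCube ..) hdisj]
    _ ≤ 3 ^ n * ∫⁻ x in tripleCube n l m, h x := by
        gcongr
        exact Set.iUnion₂_subset fun b hb =>
          tripleCube_subset_of_dyadicCube_subset hn (hsub b (hu hb))

lemma four_mul_volume_iUnion_dyadicCube_le {n : ℕ} (hn : 0 < n)
    (h : EuclideanSpace ℝ (Fin n) → ℝ≥0∞) (l : ℤ) (m : Fin n → ℤ)
    (hfin : ∫⁻ x in tripleCube n l m, h x ≠ ∞) (T : Set (ℤ × (Fin n → ℤ)))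
    (hsub : ∀ r ∈ T, dyadicCube n r.1 r.2 ⊆ dyadicCube n l m)
    (hT : ∀ r ∈ T, 4 * 9 ^ n * setAvg (tripleCube n l m) h <
      setAvg (tripleCube n r.1 r.2) h) :
    4 * volume (⋃ r ∈ T, dyadicCube n r.1 r.2) ≤ volume (dyadicCube n l m) := by
  have key := mul_volume_iUnion_dyadicCube_le hn h l m _ T hsub fun r hr => (hT r hr).le
  by_cases h0 : ∫⁻ x in tripleCube n l m, h x = 0
  · have hempty : T = ∅ := by
      refine Set.eq_empty_of_forall_notMem fun r hr => ?_
      have h1 : ∫⁻ x in tripleCube n r.1 r.2, h x = 0 := le_antisymm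
        ((lintegral_mono_set (tripleCube_subset_of_dyadicCube_subset hn (hsub r hr))).trans h0.le)
        zero_le
      have h2 := hT r hr
      simp [setAvg, h1] at h2
    simp [hempty]
  · set I := ∫⁻ x in tripleCube n l m, h x
    set U := volume (⋃ r ∈ T, dyadicCube n r.1 r.2)
    set V := volume (dyadicCube n l m)
    have hW : 3 ^ n * V * (volume (tripleCube n l m))⁻¹ = 1 := by
      rw [← volume_tripleCube]
      exact ENNReal.mul_inv_cancel (volume_tripleCube_ne_zero n l m) (volume_tripleCube_ne_top n l m)
    have h9 : (9 : ℝ≥0∞) ^ n = 3 ^ n * 3 ^ n := by rw [← mul_pow]; norm_num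
    have hle : 3 ^ n * I * (4 * U) ≤ 3 ^ n * I * V := by
      calc 3 ^ n * I * (4 * U)
          = 3 ^ n * I * (4 * U) * (3 ^ n * V * (volume (tripleCube n l m))⁻¹) := by
            rw [hW, mul_one]
        _ = 4 * 9 ^ n * setAvg (tripleCube n l m) h * U * V := by
            rw [setAvg, h9]; ring
        _ ≤ 3 ^ n * I * V := by gcongr
    exact (ENNReal.mul_le_mul_iff_right (mul_ne_zero (by positivity) h0)
      (ENNReal.mul_ne_top (by finiteness) hfin)).1 hle

lemma czAvg_le_of_setAvg_le {n : ℕ} {θ₁ θ₂ : ℝ} (hθ₁ : 0 < θ₁) (hθ₂ : 0 < θ₂)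
    {f g : EuclideanSpace ℝ (Fin n) → ℝ≥0∞} {K : ℝ≥0∞} {l l' : ℤ} {m m' : Fin n → ℤ}
    (hf : setAvg (tripleCube n l' m') (fun x => f x ^ θ₁) ≤
      K * setAvg (tripleCube n l m) fun x => f x ^ θ₁)
    (hg : setAvg (tripleCube n l' m') (fun x => g x ^ θ₂) ≤
      K * setAvg (tripleCube n l m) fun x => g x ^ θ₂) :
    czAvg θ₁ θ₂ f g l' m' ≤ K ^ (1 / θ₁ + 1 / θ₂) * czAvg θ₁ θ₂ f g l m := by
  have ha : 0 ≤ 1 / θ₁ := by positivity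
  have hb : 0 ≤ 1 / θ₂ := by positivity
  refine (mul_le_mul' (ENNReal.rpow_le_rpow hf ha) (ENNReal.rpow_le_rpow hg hb)).trans_eq ?_
  rw [ENNReal.mul_rpow_of_nonneg _ _ ha, ENNReal.mul_rpow_of_nonneg _ _ hb,
    ENNReal.rpow_add_of_nonneg _ _ ha hb, czAvg]
  ring

lemma setAvg_tripleCube_le_of_subset {n : ℕ} (hn : 0 < n)
    (h : EuclideanSpace ℝ (Fin n) → ℝ≥0∞) {l : ℤ} {m m' : Fin n → ℤ}
    (hsub : dyadicCube n l m ⊆ dyadicCube n (l - 1) m') :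
    setAvg (tripleCube n l m) h ≤ 2 ^ n * setAvg (tripleCube n (l - 1) m') h := by
  have hvol : volume (tripleCube n (l - 1) m') = 2 ^ n * volume (tripleCube n l m) := by
    rw [volume_tripleCube, volume_tripleCube, volume_dyadicCube, volume_dyadicCube,
      mul_left_comm, ← mul_pow 2]
    congr 2
    rw [show (2 : ℝ≥0∞) = ENNReal.ofReal 2 by norm_num, ← ENNReal.ofReal_mul (by norm_num),
      zpow_sub_one₀ two_ne_zero]
    congr 1
    field_simp
  rw [setAvg, setAvg, hvol, ENNReal.mul_inv (.inl (by positivity)) (.inl (by finiteness)),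
    ← mul_assoc, ← mul_assoc, ENNReal.mul_inv_cancel (by positivity) (by finiteness), one_mul]
  gcongr
  exact tripleCube_subset_of_dyadicCube_subset hn hsub

lemma exists_dyadicCube_parent {n : ℕ} (l : ℤ) (m : Fin n → ℤ) :
    ∃ m', dyadicCube n l m ⊆ dyadicCube n (l - 1) m' := by
  obtain ⟨x, hx⟩ := dyadicCube_nonempty n l m
  refine ⟨fun i => ⌊(2 : ℝ) ^ (l - 1) * x i⌋, dyadicCube_subset_of_inter_nonempty (by lia)
    ⟨x, hx, fun i => ⟨Int.floor_le _, Int.lt_floor_add_one _⟩⟩⟩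

lemma volume_dyadicCube_le_two_mul_diff {n : ℕ} (hn : 0 < n) {θ₁ θ₂ : ℝ} (hθ₁ : 0 < θ₁)
    (hθ₂ : 0 < θ₂) (f g : EuclideanSpace ℝ (Fin n) → ℝ≥0∞) (l : ℤ) (m : Fin n → ℤ)
    (hf : (∫⁻ x in tripleCube n l m, f x ^ θ₁) ≠ ∞)
    (hg : (∫⁻ x in tripleCube n l m, g x ^ θ₂) ≠ ∞)
    (S : Set (EuclideanSpace ℝ (Fin n)))
    (hS : ∀ x ∈ dyadicCube n l m ∩ S, ∃ l' m', x ∈ dyadicCube n l' m' ∧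
      dyadicCube n l' m' ⊆ dyadicCube n l m ∧
      (4 * 9 ^ n) ^ (1 / θ₁ + 1 / θ₂) * czAvg θ₁ θ₂ f g l m < czAvg θ₁ θ₂ f g l' m') :
    volume (dyadicCube n l m) ≤ 2 * volume (dyadicCube n l m \ S) := by
  let T (h : EuclideanSpace ℝ (Fin n) → ℝ≥0∞) : Set (ℤ × (Fin n → ℤ)) :=
    {r | dyadicCube n r.1 r.2 ⊆ dyadicCube n l m ∧
      4 * 9 ^ n * setAvg (tripleCube n l m) h < setAvg (tripleCube n r.1 r.2) h}
  have hTf := four_mul_volume_iUnion_dyadicCube_le hn _ l m hf (T fun x => f x ^ θ₁)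
    (fun r hr => hr.1) fun r hr => hr.2
  have hTg := four_mul_volume_iUnion_dyadicCube_le hn _ l m hg (T fun x => g x ^ θ₂)
    (fun r hr => hr.1) fun r hr => hr.2
  have hcover : dyadicCube n l m ∩ S ⊆ (⋃ r ∈ T fun x => f x ^ θ₁, dyadicCube n r.1 r.2) ∪
      ⋃ r ∈ T fun x => g x ^ θ₂, dyadicCube n r.1 r.2 := by
    intro x hx
    obtain ⟨l', m', hxr, hr, hlt⟩ := hS x hx
    by_contra hnot
    rw [Set.mem_union, not_or, Set.mem_iUnion₂, Set.mem_iUnion₂] at hnot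
    refine hlt.not_ge (czAvg_le_of_setAvg_le hθ₁ hθ₂ ?_ ?_) <;> by_contra! hc
    · exact hnot.1 ⟨(l', m'), ⟨hr, hc⟩, hxr⟩
    · exact hnot.2 ⟨(l', m'), ⟨hr, hc⟩, hxr⟩
  have hhalf : 2 * volume (dyadicCube n l m ∩ S) ≤ volume (dyadicCube n l m) := by
    refine (ENNReal.mul_le_mul_iff_right two_ne_zero ENNReal.ofNat_ne_top).1 ?_
    calc 2 * (2 * volume (dyadicCube n l m ∩ S))
        = 4 * volume (dyadicCube n l m ∩ S) := by rw [← mul_assoc]; norm_num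
      _ ≤ 4 * (volume (⋃ r ∈ T fun x => f x ^ θ₁, dyadicCube n r.1 r.2) +
          volume (⋃ r ∈ T fun x => g x ^ θ₂, dyadicCube n r.1 r.2)) := by
        gcongr
        exact (measure_mono hcover).trans (measure_union_le _ _)
      _ ≤ 2 * volume (dyadicCube n l m) := by
        rw [mul_add, two_mul]
        exact add_le_add hTf hTg
  have hsplit := measure_le_inter_add_sdiff volume (dyadicCube n l m) S
  refine (ENNReal.add_le_add_iff_left (volume_dyadicCube_ne_top n l m)).1 ?_
  calc volume (dyadicCube n l m) + volume (dyadicCube n l m)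
      = 2 * volume (dyadicCube n l m) := (two_mul _).symm
    _ ≤ 2 * volume (dyadicCube n l m ∩ S) + 2 * volume (dyadicCube n l m \ S) := by
      rw [← mul_add]; gcongr
    _ ≤ _ := by gcongr

lemma czAvg_le_of_dyadicCube_maximal {n : ℕ} (hn : 0 < n) {θ₁ θ₂ : ℝ} (hθ₁ : 0 < θ₁)
    (hθ₂ : 0 < θ₂) {f g : EuclideanSpace ℝ (Fin n) → ℝ≥0∞} {k₀ l : ℤ} {m₀ m : Fin n → ℤ}
    {c : ℝ≥0∞} (hc : czAvg θ₁ θ₂ f g k₀ m₀ ≤ c)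
    (hsub : dyadicCube n l m ⊆ dyadicCube n k₀ m₀) (hlt : c < czAvg θ₁ θ₂ f g l m)
    (hmax : ∀ Q' ∈ czFamily θ₁ θ₂ f g (dyadicCube n k₀ m₀) c,
      dyadicCube n l m ⊆ Q' → Q' = dyadicCube n l m) :
    czAvg θ₁ θ₂ f g l m ≤ (2 ^ n) ^ (1 / θ₁ + 1 / θ₂) * c := by
  have hne : (dyadicCube n l m ∩ dyadicCube n k₀ m₀).Nonempty := by
    rw [Set.inter_eq_left.2 hsub]; exact dyadicCube_nonempty ..
  have hl : k₀ < l := by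
    refine (le_of_dyadicCube_subset hn hsub).lt_of_ne ?_
    rintro rfl
    obtain rfl := dyadicCube_index_eq hne
    exact hlt.not_ge hc
  obtain ⟨m', hm'⟩ := exists_dyadicCube_parent l m
  have hparent : czAvg θ₁ θ₂ f g (l - 1) m' ≤ c := by
    by_contra! hc'
    have hP : dyadicCube n (l - 1) m' ⊆ dyadicCube n k₀ m₀ :=
      dyadicCube_subset_of_inter_nonempty (by lia)
        (hne.mono (Set.inter_subset_inter_left _ hm'))
    have := hmax _ ⟨l - 1, m', rfl, hP, hc'⟩ hm'
    have := le_of_dyadicCube_subset hn this.le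
    lia
  refine (czAvg_le_of_setAvg_le hθ₁ hθ₂ (setAvg_tripleCube_le_of_subset hn _ hm')
    (setAvg_tripleCube_le_of_subset hn _ hm')).trans ?_
  gcongr

/-- Lemma 3.3 of the paper (Calderón–Zygmund decomposition): bounds on the averages over
the maximal cubes `Q_j^k` and the estimates `|Q₀| ≤ 2|E₀|`, `|Q_j^k| ≤ 2|E_j^k|`. -/
theorem cz_decomposition
    (n : ℕ) (hn : 0 < n) (θ₁ θ₂ : ℝ) (hθ₁ : 1 < θ₁) (hθ₂ : 1 < θ₂)
    (k₀ : ℤ) (m₀ : Fin n → ℤ)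
    (f g : EuclideanSpace ℝ (Fin n) → ℝ≥0∞) (hf : Measurable f) (hg : Measurable g)
    (hfloc : ∀ (l : ℤ) (m : Fin n → ℤ), (∫⁻ x in tripleCube n l m, f x ^ θ₁) ≠ ∞)
    (hgloc : ∀ (l : ℤ) (m : Fin n → ℤ), (∫⁻ x in tripleCube n l m, g x ^ θ₂) ≠ ∞)
    (hγ : 0 < czAvg θ₁ θ₂ f g k₀ m₀) :
    (∀ k : ℕ, 1 ≤ k → ∀ (l : ℤ) (m : Fin n → ℤ),
        dyadicCube n l m ∈ czFamily θ₁ θ₂ f g (dyadicCube n k₀ m₀)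
          (czAvg θ₁ θ₂ f g k₀ m₀ *
            ENNReal.ofReal ((4 * 18 ^ n : ℝ) ^ (1 / θ₁ + 1 / θ₂)) ^ k) →
        (∀ Q' ∈ czFamily θ₁ θ₂ f g (dyadicCube n k₀ m₀)
            (czAvg θ₁ θ₂ f g k₀ m₀ *
              ENNReal.ofReal ((4 * 18 ^ n : ℝ) ^ (1 / θ₁ + 1 / θ₂)) ^ k),
          dyadicCube n l m ⊆ Q' → Q' = dyadicCube n l m) →
        (czAvg θ₁ θ₂ f g k₀ m₀ *
              ENNReal.ofReal ((4 * 18 ^ n : ℝ) ^ (1 / θ₁ + 1 / θ₂)) ^ k <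
            czAvg θ₁ θ₂ f g l m ∧
          czAvg θ₁ θ₂ f g l m ≤
            ENNReal.ofReal ((2 : ℝ) ^ ((n : ℝ) * (1 / θ₁ + 1 / θ₂))) *
              (czAvg θ₁ θ₂ f g k₀ m₀ *
                ENNReal.ofReal ((4 * 18 ^ n : ℝ) ^ (1 / θ₁ + 1 / θ₂)) ^ k) ∧
          volume (dyadicCube n l m) ≤
            2 * volume (dyadicCube n l m \
              ⋃₀ czFamily θ₁ θ₂ f g (dyadicCube n k₀ m₀)
                (czAvg θ₁ θ₂ f g k₀ m₀ *
                  ENNReal.ofReal ((4 * 18 ^ n : ℝ) ^ (1 / θ₁ + 1 / θ₂)) ^ (k + 1))))) ∧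
      volume (dyadicCube n k₀ m₀) ≤
        2 * volume (dyadicCube n k₀ m₀ \
          ⋃₀ czFamily θ₁ θ₂ f g (dyadicCube n k₀ m₀)
            (czAvg θ₁ θ₂ f g k₀ m₀ *
              ENNReal.ofReal ((4 * 18 ^ n : ℝ) ^ (1 / θ₁ + 1 / θ₂)) ^ (1 : ℕ))) := by
  have h₁ : 0 < θ₁ := by linarith
  have h₂ : 0 < θ₂ := by linarith
  have hs : 0 ≤ 1 / θ₁ + 1 / θ₂ := by positivity
  have hK : ENNReal.ofReal ((2 : ℝ) ^ ((n : ℝ) * (1 / θ₁ + 1 / θ₂))) =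
      (2 ^ n) ^ (1 / θ₁ + 1 / θ₂) := by
    rw [Real.rpow_mul (by norm_num), Real.rpow_natCast,
      ← ENNReal.ofReal_rpow_of_pos (by positivity), ENNReal.ofReal_pow (by norm_num),
      ENNReal.ofReal_ofNat]
  have hA : ENNReal.ofReal ((4 * 18 ^ n : ℝ) ^ (1 / θ₁ + 1 / θ₂)) =
      (4 * 9 ^ n) ^ (1 / θ₁ + 1 / θ₂) * (2 ^ n) ^ (1 / θ₁ + 1 / θ₂) := by
    rw [← ENNReal.ofReal_rpow_of_pos (by positivity), ← ENNReal.mul_rpow_of_nonneg _ _ hs,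
      mul_assoc, ← mul_pow, ENNReal.ofReal_mul (by norm_num), ENNReal.ofReal_pow (by norm_num),
      ENNReal.ofReal_ofNat, ENNReal.ofReal_ofNat]
    norm_num
  have hK1 : (1 : ℝ≥0∞) ≤ (2 ^ n) ^ (1 / θ₁ + 1 / θ₂) :=
    ENNReal.one_le_rpow (one_le_pow₀ one_le_two) (by positivity)
  have hC1 : (1 : ℝ≥0∞) ≤ (4 * 9 ^ n) ^ (1 / θ₁ + 1 / θ₂) :=
    ENNReal.one_le_rpow (one_le_mul (by norm_num) (one_le_pow₀ (by norm_num))) (by positivity)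
  rw [hK, hA]
  generalize hKdef : ((2 : ℝ≥0∞) ^ n) ^ (1 / θ₁ + 1 / θ₂) = K at *
  generalize hCdef : ((4 : ℝ≥0∞) * 9 ^ n) ^ (1 / θ₁ + 1 / θ₂) = C at *
  have hCK : 1 ≤ C * K := one_le_mul hC1 hK1
  refine ⟨fun k _ l m hmem hmax => ?_, ?_⟩
  · obtain ⟨l₁, m₁, heq, hsub, hlt₁⟩ := hmem
    obtain ⟨rfl, rfl⟩ := dyadicCube_injective hn heq
    have hc : czAvg θ₁ θ₂ f g k₀ m₀ ≤ czAvg θ₁ θ₂ f g k₀ m₀ * (C * K) ^ k :=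
      le_mul_of_one_le_right' (one_le_pow₀ hCK)
    have hupper := czAvg_le_of_dyadicCube_maximal hn h₁ h₂ hc hsub hlt₁ hmax
    rw [hKdef] at hupper
    refine ⟨hlt₁, hupper, ?_⟩
    refine volume_dyadicCube_le_two_mul_diff hn h₁ h₂ f g l m (hfloc _ _) (hgloc _ _) _ ?_
    rintro x ⟨hxQ, _, ⟨l', m', rfl, hsub', hlt⟩, hx⟩
    refine ⟨l', m', hx, ?_, lt_of_le_of_lt ?_ hlt⟩
    · obtain hle | hle := le_total l l'
      · exact dyadicCube_subset_of_inter_nonempty hle ⟨x, hx, hxQ⟩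
      · refine (hmax _ ⟨l', m', rfl, hsub', lt_of_le_of_lt ?_ hlt⟩
          (dyadicCube_subset_of_inter_nonempty hle ⟨x, hxQ, hx⟩)).le
        gcongr
        exact k.le_succ
    · calc (4 * 9 ^ n) ^ (1 / θ₁ + 1 / θ₂) * czAvg θ₁ θ₂ f g l m
          ≤ C * (K * (czAvg θ₁ θ₂ f g k₀ m₀ * (C * K) ^ k)) := by rw [hCdef]; gcongr
        _ = czAvg θ₁ θ₂ f g k₀ m₀ * (C * K) ^ (k + 1) := by ring
  · refine volume_dyadicCube_le_two_mul_diff hn h₁ h₂ f g k₀ m₀ (hfloc _ _) (hgloc _ _) _ ?_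
    rintro x ⟨-, _, ⟨l, m, rfl, hsub, hlt⟩, hx⟩
    refine ⟨l, m, hx, hsub, lt_of_le_of_lt ?_ hlt⟩
    rw [hCdef, pow_one, mul_comm]
    gcongr
    exact le_mul_of_one_le_right' hK1
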